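/- Let F : {(t,s) : -t ≤ s ≤ t} → ℂ be C¹ in s and let γ be the contour from e^{iπ/4}∞ to 0 to +∞. Then for -t < s < t, ∫_γ k⁵ ∫_{-t}^t F(t,s') e^{2ik⁴(s'-s)} ds' dk = -(c₁π/2i)·(𝒜⁻¹F)(t,s), where c₁ = √π e^{-iπ/4}/(2√2) and (𝒜⁻¹F)(t,s) = (1/π)[∫_{-t}^s (∂F/∂s')(t,s')(s-s')^{-1/2} ds' + F(t,-t)(t+s)^{-1/2}]. -/

import Mathlib

open Filter MeasureTheory

/-- Truncated contour integral along `γ_R = [R e^{iπ/4}, 0] ∪ [0, R]`. -/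
noncomputable def gammaTrunc (f : ℂ → ℂ) (R : ℝ) : ℂ :=
  ∫ r in (0:ℝ)..R,
    (f (r : ℂ) - Complex.exp (Real.pi * Complex.I / 4) *
      f ((r : ℂ) * Complex.exp (Real.pi * Complex.I / 4)))

/-- The constant `c₁ = √π e^{-iπ/4}/(2√2)`. -/
noncomputable def c1 : ℂ :=
  (Real.sqrt Real.pi : ℂ) * Complex.exp (-(Real.pi : ℂ) * Complex.I / 4) /
    (2 * (Real.sqrt 2 : ℂ))

/-- The inverse Abel transform (in the second variable) of `F`, in derivative-free form:
`(𝒜⁻¹F)(t,s) = (1/π)[∫_{-t}^s F_{s'}(t,s')(s-s')^{-1/2} ds' + F(t,-t)(t+s)^{-1/2}]`. -/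
noncomputable def abelInv (F : ℝ → ℝ → ℂ) (t s : ℝ) : ℂ :=
  (1 / (Real.pi : ℂ)) *
    ((∫ s' in (-t)..s, deriv (F t) s' / (Real.sqrt (s - s') : ℂ)) +
      F t (-t) / (Real.sqrt (t + s) : ℂ))

lemma gk_tail (b : ℂ) (hb : 0 ≤ b.re) (hb0 : b ≠ 0) (R S : ℝ) (hR : 0 < R) (hRS : R ≤ S) :
    ‖∫ u in R..S, Complex.exp (-b * (u:ℂ) ^ 2)‖ ≤ 1 / (‖b‖ * R) := by
  have hnb : 0 < ‖b‖ := norm_pos_iff.mpr hb0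
  have hS : 0 < S := hR.trans_le hRS
  have hexp : ∀ u : ℝ, ‖Complex.exp (-b * (u:ℂ) ^ 2)‖ ≤ 1 := by
    intro u
    rw [Complex.norm_exp, Real.exp_le_one_iff]
    have : (-b * (u:ℂ)^2).re = -(b.re * u^2) := by
      rw [← Complex.ofReal_pow, Complex.re_mul_ofReal]; simp
    rw [this]; have := mul_nonneg hb (sq_nonneg u); linarith
  have hpos : ∀ u ∈ Set.uIcc R S, 0 < u := by
    intro u hu; rw [Set.uIcc_of_le hRS] at hu; exact hR.trans_le hu.1
  have hder : ∀ u ∈ Set.uIcc R S, HasDerivAt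
      (fun u : ℝ => Complex.exp (-b * (u:ℂ) ^ 2) * (-(2 * b * (u:ℂ)))⁻¹)
      (Complex.exp (-b * (u:ℂ) ^ 2) + Complex.exp (-b * (u:ℂ) ^ 2) / (2 * b * (u:ℂ)^2)) u := by
    intro u hu
    have hu0 : (u:ℂ) ≠ 0 := by exact_mod_cast (hpos u hu).ne'
    have h1 : HasDerivAt (fun z : ℂ => Complex.exp (-b * z ^ 2) * (-(2 * b * z))⁻¹)
      (Complex.exp (-b * (u:ℂ) ^ 2) + Complex.exp (-b * (u:ℂ) ^ 2) / (2 * b * (u:ℂ)^2)) (u:ℂ) := by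
      have h2 : HasDerivAt (fun z : ℂ => -b * z^2) (-b * (2 * (u:ℂ))) (u:ℂ) := by
        simpa using (hasDerivAt_pow 2 (u:ℂ)).const_mul (-b)
      have h3 : HasDerivAt (fun z : ℂ => -(2 * b * z)) (-(2*b)) (u:ℂ) := by
        simpa using ((hasDerivAt_id (u:ℂ)).const_mul (2*b)).fun_neg
      have h4 := h2.cexp.fun_mul (h3.fun_inv (by simp [hb0, hu0]))
      refine h4.congr_deriv ?_
      field_simp
    exact h1.comp_ofReal
  have hcE : Continuous (fun u : ℝ => Complex.exp (-b * (u:ℂ) ^ 2)) := by fun_prop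
  have hc2 : ContinuousOn (fun u : ℝ => Complex.exp (-b * (u:ℂ) ^ 2) / (2 * b * (u:ℂ)^2))
      (Set.uIcc R S) := by
    apply hcE.continuousOn.div (by fun_prop)
    intro u hu
    have hu0 : (u:ℂ) ≠ 0 := by exact_mod_cast (hpos u hu).ne'
    simp [hb0, hu0]
  have hi1 : IntervalIntegrable (fun u : ℝ => Complex.exp (-b * (u:ℂ) ^ 2)) volume R S :=
    hcE.intervalIntegrable _ _
  have hi2 := hc2.intervalIntegrable (μ := volume)
  have hftc1 := intervalIntegral.integral_eq_sub_of_hasDerivAt hder (hi1.add hi2)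
  rw [intervalIntegral.integral_add hi1 hi2] at hftc1
  have hder2 : ∀ u ∈ Set.uIcc R S, HasDerivAt (fun u : ℝ => -(2 * ‖b‖)⁻¹ * u⁻¹)
      ((2 * ‖b‖)⁻¹ * (u^2)⁻¹) u := by
    intro u hu
    have := (hasDerivAt_inv (hpos u hu).ne').const_mul (-(2 * ‖b‖)⁻¹)
    exact this.congr_deriv (by ring)
  have hi3 : IntervalIntegrable (fun u : ℝ => (2 * ‖b‖)⁻¹ * (u^2)⁻¹) volume R S := by
    apply ContinuousOn.intervalIntegrable
    apply continuousOn_const.mul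
    apply ContinuousOn.inv₀ (by fun_prop)
    intro u hu; exact pow_ne_zero _ (hpos u hu).ne'
  have hftc2 := intervalIntegral.integral_eq_sub_of_hasDerivAt hder2 hi3
  have hb2 : ‖∫ u in R..S, Complex.exp (-b * (u:ℂ) ^ 2) / (2 * b * (u:ℂ)^2)‖ ≤
      ∫ u in R..S, (2 * ‖b‖)⁻¹ * (u^2)⁻¹ := by
    apply intervalIntegral.norm_integral_le_of_norm_le hRS _ hi3
    refine Filter.Eventually.of_forall fun u _ => ?_
    rw [norm_div, div_eq_mul_inv, ← mul_inv]
    have : ‖2 * b * (u:ℂ)^2‖ = 2 * ‖b‖ * u^2 := by simp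
    rw [this]
    exact (mul_le_mul_of_nonneg_right (hexp u) (by positivity)).trans (by rw [one_mul])
  have hbd : ∀ u : ℝ, 0 < u → ‖Complex.exp (-b * (u:ℂ) ^ 2) * (-(2 * b * (u:ℂ)))⁻¹‖ ≤
      (2 * ‖b‖)⁻¹ * u⁻¹ := by
    intro u hu
    rw [norm_mul, norm_inv, norm_neg]
    have : ‖2 * b * (u:ℂ)‖ = 2 * ‖b‖ * u := by simp [abs_of_pos hu]
    rw [this, ← mul_inv]
    exact (mul_le_mul_of_nonneg_right (hexp u) (by positivity)).trans (by rw [one_mul])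
  have e := eq_sub_of_add_eq hftc1
  rw [e]
  have hR1 := hbd R hR
  have hS1 := hbd S hS
  have n1 := norm_sub_le (Complex.exp (-b * (S:ℂ) ^ 2) * (-(2 * b * (S:ℂ)))⁻¹ -
    Complex.exp (-b * (R:ℂ) ^ 2) * (-(2 * b * (R:ℂ)))⁻¹)
    (∫ u in R..S, Complex.exp (-b * (u:ℂ) ^ 2) / (2 * b * (u:ℂ)^2))
  have n2 := norm_sub_le (Complex.exp (-b * (S:ℂ) ^ 2) * (-(2 * b * (S:ℂ)))⁻¹)
    (Complex.exp (-b * (R:ℂ) ^ 2) * (-(2 * b * (R:ℂ)))⁻¹)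
  have e3 : 1 / (‖b‖ * R) = 2 * ((2 * ‖b‖)⁻¹ * R⁻¹) := by field_simp
  rw [e3]
  rw [hftc2] at hb2
  linarith

lemma gk_fresnel_pos (b : ℂ) (hb : 0 < b.re) (R : ℝ) (hR : 0 < R) :
    ‖(∫ u in (0:ℝ)..R, Complex.exp (-b * (u:ℂ) ^ 2)) - ((Real.pi:ℂ) / b) ^ (1 / 2 : ℂ) / 2‖
      ≤ 1 / (‖b‖ * R) := by
  have hb0 : b ≠ 0 := by rintro rfl; simp at hb
  have hlim := MeasureTheory.intervalIntegral_tendsto_integral_Ioi (0:ℝ)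
    (integrable_cexp_neg_mul_sq hb).integrableOn tendsto_id
  rw [integral_gaussian_complex_Ioi hb] at hlim
  have h2 := (tendsto_const_nhds (x := ∫ u in (0:ℝ)..R, Complex.exp (-b * (u:ℂ) ^ 2))).sub hlim
  refine le_of_tendsto h2.norm ?_
  filter_upwards [eventually_ge_atTop R] with S hS
  have hcE : Continuous (fun u : ℝ => Complex.exp (-b * (u:ℂ) ^ 2)) := by fun_prop
  rw [norm_sub_rev, id, intervalIntegral.integral_interval_sub_left
    (hcE.intervalIntegrable _ _) (hcE.intervalIntegrable _ _)]
  exact gk_tail b hb.le hb0 R S hR hS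

lemma gk_fresnel (b : ℂ) (hb : 0 ≤ b.re) (hb0 : b ≠ 0) (R : ℝ) (hR : 0 < R) :
    ‖(∫ u in (0:ℝ)..R, Complex.exp (-b * (u:ℂ) ^ 2)) - ((Real.pi:ℂ) / b) ^ (1 / 2 : ℂ) / 2‖
      ≤ 1 / (‖b‖ * R) := by
  have hc1 : Continuous (fun z : ℂ => ∫ u in (0:ℝ)..R, Complex.exp (-z * (u:ℂ) ^ 2)) := by
    apply intervalIntegral.continuous_parametric_intervalIntegral_of_continuous'
    simp only [Function.uncurry_def]
    fun_prop
  have hslit : (Real.pi:ℂ) / b ∈ Complex.slitPlane := by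
    rw [Complex.mem_slitPlane_iff]
    have hn : 0 < Complex.normSq b := Complex.normSq_pos.mpr hb0
    have hpi := Real.pi_pos
    rcases hb.lt_or_eq with h | h
    · left
      simp only [Complex.div_re, Complex.ofReal_re, Complex.ofReal_im, zero_mul, zero_div, add_zero]
      positivity
    · right
      have him : b.im ≠ 0 := fun h' => hb0 (Complex.ext h.symm h')
      simp only [Complex.div_im, Complex.ofReal_re, Complex.ofReal_im, zero_mul, zero_div, zero_sub]
      rw [neg_ne_zero]
      positivity
  have hc2 : ContinuousAt (fun z : ℂ => ((Real.pi:ℂ) / z) ^ (1 / 2 : ℂ)) b :=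
    ContinuousAt.cpow (continuousAt_const.div continuousAt_id hb0) continuousAt_const hslit
  have hc3 : ContinuousAt (fun z : ℂ => ‖(∫ u in (0:ℝ)..R, Complex.exp (-z * (u:ℂ) ^ 2)) -
      ((Real.pi:ℂ) / z) ^ (1 / 2 : ℂ) / 2‖) b :=
    (hc1.continuousAt.sub (hc2.div_const 2)).norm
  have hc4 : ContinuousAt (fun z : ℂ => 1 / (‖z‖ * R)) b := by
    apply continuousAt_const.div (by fun_prop)
    have := norm_pos_iff.mpr hb0
    positivity
  have hl : Tendsto (fun ε : ℝ => b + (ε:ℂ)) (nhdsWithin 0 (Set.Ioi 0)) (nhds b) := by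
    have : Continuous (fun ε : ℝ => b + (ε:ℂ)) := by fun_prop
    simpa using (this.tendsto 0).mono_left nhdsWithin_le_nhds
  refine le_of_tendsto_of_tendsto (hc3.tendsto.comp hl) (hc4.tendsto.comp hl) ?_
  filter_upwards [self_mem_nhdsWithin] with ε hε
  apply gk_fresnel_pos _ _ _ hR
  simp only [Set.mem_Ioi] at hε
  simp; linarith

lemma gk_om : Complex.exp (Real.pi * Complex.I / 4) =
    Complex.I * Complex.exp (-(Real.pi : ℂ) * Complex.I / 4) := by
  nth_rewrite 2 [← Complex.exp_pi_div_two_mul_I]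
  rw [← Complex.exp_add]; congr 1; ring

lemma gk_om_sq : Complex.exp (Real.pi * Complex.I / 4) ^ 2 = Complex.I := by
  rw [← Complex.exp_nat_mul]
  conv_rhs => rw [← Complex.exp_pi_div_two_mul_I]
  congr 1; push_cast; ring

lemma gk_om'_sq : Complex.exp (-(Real.pi : ℂ) * Complex.I / 4) ^ 2 = -Complex.I := by
  have h := gk_om_sq
  rw [gk_om, mul_pow, Complex.I_sq] at h
  linear_combination -h

lemma gk_re (x : ℝ) (hx : |x| = Real.pi / 4) (c : ℝ) (hc : 0 < c) :
    0 < ((c:ℂ) * Complex.exp (x * Complex.I)).re := by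
  rw [Complex.re_ofReal_mul, Complex.exp_ofReal_mul_I_re]
  have hpi := Real.pi_pos
  have := abs_le.mp hx.le
  exact mul_pos hc (Real.cos_pos_of_mem_Ioo ⟨by linarith, by linarith⟩)

lemma gk_cpow1 (σ : ℝ) (hσ : 0 < σ) : ((Real.pi:ℂ) / (-(2 * Complex.I * σ))) ^ (1 / 2 : ℂ) =
    (Real.sqrt (Real.pi / (2 * σ)) : ℂ) * Complex.exp (Real.pi * Complex.I / 4) := by
  have hpi := Real.pi_pos
  have hs : (0:ℝ) < Real.pi / (2 * σ) := by positivity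
  have h := gk_re (Real.pi / 4) (abs_of_pos (by positivity)) _ (Real.sqrt_pos.mpr hs)
  have e : (((Real.pi / 4 : ℝ) : ℂ) * Complex.I) = Real.pi * Complex.I / 4 := by push_cast; ring
  rw [e] at h
  rw [← Complex.sq_cpow_two_inv h, one_div, mul_pow, gk_om_sq, ← Complex.ofReal_pow,
    Real.sq_sqrt hs.le]
  congr 1
  have : (σ:ℂ) ≠ 0 := by exact_mod_cast hσ.ne'
  push_cast
  field_simp
  linear_combination -Complex.I_sq

lemma gk_cpow2 (σ : ℝ) (hσ : 0 < σ) : ((Real.pi:ℂ) / (2 * Complex.I * σ)) ^ (1 / 2 : ℂ) =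
    (Real.sqrt (Real.pi / (2 * σ)) : ℂ) * Complex.exp (-(Real.pi:ℂ) * Complex.I / 4) := by
  have hpi := Real.pi_pos
  have hs : (0:ℝ) < Real.pi / (2 * σ) := by positivity
  have h := gk_re (-(Real.pi / 4)) (by rw [abs_neg]; exact abs_of_pos (by positivity)) _
    (Real.sqrt_pos.mpr hs)
  have e : (((-(Real.pi / 4) : ℝ) : ℂ) * Complex.I) = -(Real.pi:ℂ) * Complex.I / 4 := by
    push_cast; ring
  rw [e] at h
  rw [← Complex.sq_cpow_two_inv h, one_div, mul_pow, gk_om'_sq, ← Complex.ofReal_pow,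
    Real.sq_sqrt hs.le]
  congr 1
  have : (σ:ℂ) ≠ 0 := by exact_mod_cast hσ.ne'
  push_cast
  field_simp
  linear_combination Complex.I_sq

noncomputable def gkE (R τ : ℝ) : ℂ :=
  ∫ r in (0:ℝ)..R, (r:ℂ) * (Complex.exp (2 * Complex.I * (r:ℂ)^4 * τ) -
    Complex.I * Complex.exp (-(2 * Complex.I * (r:ℂ)^4 * τ)))

lemma gkE_eq (R τ : ℝ) : gkE R τ = (1/2) * (
    (∫ u in (0:ℝ)..R^2, Complex.exp (-(-(2 * Complex.I * τ)) * (u:ℂ)^2)) -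
     Complex.I * ∫ u in (0:ℝ)..R^2, Complex.exp (-(2 * Complex.I * τ) * (u:ℂ)^2)) := by
  have hc1 : Continuous fun u : ℝ => Complex.exp (-(-(2 * Complex.I * τ)) * (u:ℂ)^2) := by fun_prop
  have hc2 : Continuous fun u : ℝ => Complex.exp (-(2 * Complex.I * τ) * (u:ℂ)^2) := by fun_prop
  have hc3 : Continuous fun u : ℝ => Complex.I * Complex.exp (-(2 * Complex.I * τ) * (u:ℂ)^2) := by
    fun_prop
  rw [← intervalIntegral.integral_const_mul, ← intervalIntegral.integral_sub
    (hc1.intervalIntegrable _ _) (hc3.intervalIntegrable _ _)]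
  have := intervalIntegral.integral_deriv_smul_comp (a := 0) (b := R) (f := fun x => x^2)
    (f' := fun x => 2 * x) (g := fun u : ℝ => Complex.exp (-(-(2 * Complex.I * τ)) * (u:ℂ)^2) -
      Complex.I * Complex.exp (-(2 * Complex.I * τ) * (u:ℂ)^2))
    (fun x _ => by simpa using hasDerivAt_pow 2 x) (by fun_prop) (by fun_prop)
  simp only [ne_eq, OfNat.ofNat_ne_zero, not_false_eq_true, zero_pow] at this
  rw [← this, gkE, ← intervalIntegral.integral_const_mul]
  congr 1; ext r
  simp only [Function.comp, Complex.real_smul]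
  push_cast
  have e1 : -(-(2 * Complex.I * τ)) * ((r:ℂ)^2)^2 = 2 * Complex.I * (r:ℂ)^4 * τ := by ring
  have e2 : -(2 * Complex.I * τ) * ((r:ℂ)^2)^2 = -(2 * Complex.I * (r:ℂ)^4 * τ) := by ring
  rw [e1, e2]; ring

/-- limit kernel -/
noncomputable def gkL (τ : ℝ) : ℂ := if τ < 0 then c1 / (Real.sqrt (-τ) : ℂ) else 0

lemma gkE_est (τ : ℝ) (hτ : τ ≠ 0) (R : ℝ) (hR : 0 < R) :
    ‖gkE R τ - gkL τ‖ ≤ 1 / (2 * |τ| * R^2) := by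
  have hR2 : 0 < R^2 := by positivity
  have hn : ‖2 * Complex.I * (τ:ℂ)‖ = 2 * |τ| := by simp
  have hne : 2 * Complex.I * (τ:ℂ) ≠ 0 := by simp [hτ]
  have f1 := gk_fresnel (-(2 * Complex.I * τ)) (by simp) (neg_ne_zero.mpr hne) (R^2) hR2
  have f2 := gk_fresnel (2 * Complex.I * τ) (by simp) hne (R^2) hR2
  rw [norm_neg] at f1
  rw [hn] at f1 f2
  have hL : gkL τ = (1/2) * (((Real.pi:ℂ) / (-(2 * Complex.I * τ))) ^ (1 / 2 : ℂ) / 2 -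
      Complex.I * (((Real.pi:ℂ) / (2 * Complex.I * τ)) ^ (1 / 2 : ℂ) / 2)) := by
    rcases lt_or_gt_of_ne hτ with h | h
    · have hp : 0 < -τ := by linarith
      have g1 := gk_cpow1 (-τ) hp
      have g2 := gk_cpow2 (-τ) hp
      simp only [Complex.ofReal_neg, mul_neg, neg_neg] at g1 g2
      rw [g1, g2, gkL, if_pos h, gk_om, c1]
      have h3 : Real.sqrt (Real.pi / (2 * -τ)) = Real.sqrt Real.pi / (Real.sqrt 2 * Real.sqrt (-τ)) := by
        rw [Real.sqrt_div Real.pi_pos.le, Real.sqrt_mul (by norm_num)]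
      simp only [mul_neg] at h3
      rw [h3]
      have h4 : (Real.sqrt (-τ) : ℂ) ≠ 0 := by exact_mod_cast (Real.sqrt_pos.mpr hp).ne'
      have h5 : (Real.sqrt 2 : ℂ) ≠ 0 := by exact_mod_cast (Real.sqrt_pos.mpr (by norm_num : (0:ℝ)<2)).ne'
      push_cast
      field_simp
      linear_combination Complex.I_sq
    · rw [gk_cpow1 τ h, gk_cpow2 τ h, gkL, if_neg (not_lt.mpr h.le), gk_om]
      ring
  rw [gkE_eq, hL]
  set A := ∫ u in (0:ℝ)..R^2, Complex.exp (-(-(2 * Complex.I * τ)) * (u:ℂ)^2)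
  set B := ∫ u in (0:ℝ)..R^2, Complex.exp (-(2 * Complex.I * τ) * (u:ℂ)^2)
  set a := ((Real.pi:ℂ) / (-(2 * Complex.I * τ))) ^ (1 / 2 : ℂ) / 2
  set c := ((Real.pi:ℂ) / (2 * Complex.I * τ)) ^ (1 / 2 : ℂ) / 2
  have e : (1/2 : ℂ) * (A - Complex.I * B) - 1/2 * (a - Complex.I * c) =
      (1/2) * ((A - a) - Complex.I * (B - c)) := by ring
  rw [e, norm_mul]
  have n := norm_sub_le (A - a) (Complex.I * (B - c))
  rw [norm_mul, Complex.norm_I, one_mul] at n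
  have : ‖(1/2:ℂ)‖ = 1/2 := by norm_num
  rw [this]; linarith

lemma gkE_bound (τ : ℝ) (hτ : τ ≠ 0) (R : ℝ) (hR : 0 < R) :
    ‖gkE R τ‖ ≤ (‖c1‖ + 1) * (Real.sqrt |τ|)⁻¹ := by
  have hq : 0 < Real.sqrt |τ| := Real.sqrt_pos.mpr (abs_pos.mpr hτ)
  have hq2 : Real.sqrt |τ| ^ 2 = |τ| := Real.sq_sqrt (abs_nonneg _)
  have hc := norm_nonneg c1
  set q := Real.sqrt |τ|
  by_cases h : R^2 ≤ q⁻¹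
  · have h1 : ‖gkE R τ‖ ≤ R^2 := by
      rw [gkE]
      have : ∀ r ∈ Set.Ioc (0:ℝ) R, ‖(r:ℂ) * (Complex.exp (2 * Complex.I * (r:ℂ)^4 * τ) -
          Complex.I * Complex.exp (-(2 * Complex.I * (r:ℂ)^4 * τ)))‖ ≤ 2 * r := by
        intro r hr
        have e1 : 2 * Complex.I * (r:ℂ)^4 * τ = ((2 * r^4*τ : ℝ):ℂ) * Complex.I := by push_cast; ring
        have e2 : -(((2 * r^4*τ : ℝ):ℂ) * Complex.I) = ((-(2 * r^4*τ) : ℝ):ℂ) * Complex.I := by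
          push_cast; ring
        have n := norm_sub_le (Complex.exp (((2 * r^4*τ : ℝ):ℂ) * Complex.I))
          (Complex.I * Complex.exp (((-(2 * r^4*τ) : ℝ):ℂ) * Complex.I))
        rw [norm_mul Complex.I, Complex.norm_exp_ofReal_mul_I, Complex.norm_exp_ofReal_mul_I,
          Complex.norm_I] at n
        rw [e1, e2, norm_mul, Complex.norm_real, Real.norm_of_nonneg hr.1.le]
        nlinarith [hr.1]
      refine (intervalIntegral.norm_integral_le_of_norm_le hR.le
        (Filter.Eventually.of_forall this) ?_).trans ?_
      · exact (by fun_prop : Continuous fun r : ℝ => 2 * r).intervalIntegrable _ _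
      · rw [intervalIntegral.integral_const_mul, integral_id]; linarith
    have : 0 < q⁻¹ := by positivity
    nlinarith
  · push Not at h
    have h1 := gkE_est τ hτ R hR
    have h2 : ‖gkL τ‖ ≤ ‖c1‖ * q⁻¹ := by
      rw [gkL]
      split_ifs with hh
      · rw [norm_div, Complex.norm_real, Real.norm_of_nonneg (Real.sqrt_nonneg _),
          ← abs_of_neg hh, div_eq_mul_inv]
      · simp; positivity
    have h3 : 1 / (2 * |τ| * R^2) ≤ q⁻¹ := by
      rw [← hq2, one_div]
      apply inv_anti₀ hq
      have : 1 ≤ q * R^2 := by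
        have := mul_lt_mul_of_pos_left h hq
        rw [mul_inv_cancel₀ hq.ne'] at this
        exact this.le
      nlinarith
    have := norm_sub_norm_le (gkE R τ) (gkL τ)
    linarith

lemma gkE_tendsto (τ : ℝ) (hτ : τ ≠ 0) :
    Tendsto (fun R => gkE R τ) atTop (nhds (gkL τ)) := by
  rw [tendsto_iff_norm_sub_tendsto_zero]
  have hp : 0 < 2 * |τ| := by have := abs_pos.mpr hτ; positivity
  have : Tendsto (fun R : ℝ => 1 / (2 * |τ| * R^2)) atTop (nhds 0) :=
    tendsto_const_nhds.div_atTop ((tendsto_pow_atTop (by norm_num)).const_mul_atTop hp)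
  refine squeeze_zero' (Filter.Eventually.of_forall fun _ => norm_nonneg _) ?_ this
  filter_upwards [eventually_gt_atTop 0] with R hR using gkE_est τ hτ R hR

lemma gk_ibp (f g : ℝ → ℂ) (t s : ℝ) (ht : 0 < t) (hg : Continuous g)
    (hf : ∀ x ∈ Set.Icc (-t) t, HasDerivAt f (g x) x) (c : ℂ) :
    c * (∫ x in (-t)..t, f x * Complex.exp (c * ((x:ℂ) - (s:ℂ)))) =
      f t * Complex.exp (c * ((t - s : ℝ) : ℂ)) - f (-t) * Complex.exp (c * ((-t - s : ℝ) : ℂ)) -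
      ∫ x in (-t)..t, g x * Complex.exp (c * ((x - s : ℝ) : ℂ)) := by
  have hv : ∀ x ∈ Set.uIcc (-t) t, HasDerivAt (fun x : ℝ => Complex.exp (c * ((x - s : ℝ) : ℂ)))
      (c * Complex.exp (c * ((x:ℂ) - (s:ℂ)))) x := by
    intro x _
    have h1 : HasDerivAt (fun z : ℂ => c * (z - (s:ℂ))) c (x:ℂ) := by
      simpa using ((hasDerivAt_id (x:ℂ)).sub_const (s:ℂ)).const_mul c
    have h2 := h1.cexp.comp_ofReal
    push_cast
    exact h2.congr_deriv (by ring)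
  have hle : -t ≤ t := by linarith
  have := intervalIntegral.integral_mul_deriv_eq_deriv_mul (u := f) (u' := g)
    (fun x hx => hf x (by rwa [Set.uIcc_of_le hle] at hx)) hv
    (hg.intervalIntegrable _ _) (Continuous.intervalIntegrable (by fun_prop) _ _)
  rw [← this, ← intervalIntegral.integral_const_mul]
  congr 1; ext x; ring

noncomputable def gkK (r τ : ℝ) : ℂ := (r:ℂ) * (Complex.exp (2 * Complex.I * (r:ℂ)^4 * τ) -
    Complex.I * Complex.exp (-(2 * Complex.I * (r:ℂ)^4 * τ)))

lemma gkK_cont : Continuous (fun p : ℝ × ℝ => gkK p.1 p.2) := by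
  unfold gkK; fun_prop

lemma gk_pointwise (f g : ℝ → ℂ) (t s : ℝ) (ht : 0 < t) (hg : Continuous g)
    (hf : ∀ x ∈ Set.Icc (-t) t, HasDerivAt f (g x) x) (r : ℝ) :
    ((r:ℂ) ^ 5 * ∫ s' in (-t)..t,
          f s' * Complex.exp (2 * Complex.I * (r:ℂ) ^ 4 * ((s' : ℂ) - (s : ℂ)))) -
      Complex.exp (Real.pi * Complex.I / 4) *
        (((r : ℂ) * Complex.exp (Real.pi * Complex.I / 4)) ^ 5 * ∫ s' in (-t)..t,
          f s' * Complex.exp (2 * Complex.I * ((r : ℂ) * Complex.exp (Real.pi * Complex.I / 4)) ^ 4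
            * ((s' : ℂ) - (s : ℂ)))) =
    1 / (2 * Complex.I) * (f t * gkK r (t - s) - f (-t) * gkK r (-t - s) -
      ∫ x in (-t)..t, g x * gkK r (x - s)) := by
  have hw := gk_om_sq
  set w := Complex.exp (Real.pi * Complex.I / 4)
  have hw4 : w ^ 4 = -1 := by
    have : w ^ 4 = (w^2)^2 := by ring
    rw [this, hw, Complex.I_sq]
  have e4 : 2 * Complex.I * ((r:ℂ) * w) ^ 4 = -(2 * Complex.I * (r:ℂ)^4) := by
    rw [mul_pow, hw4]; ring
  have e6 : w * ((r:ℂ) * w) ^ 5 = - Complex.I * (r:ℂ)^5 := by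
    have : w * ((r:ℂ) * w) ^ 5 = (r:ℂ)^5 * w^4 * w^2 := by ring
    rw [this, hw4, hw]; ring
  rw [← mul_assoc w, e6, e4]
  have i1 := gk_ibp f g t s ht hg hf (2 * Complex.I * (r:ℂ)^4)
  have i2 := gk_ibp f g t s ht hg hf (-(2 * Complex.I * (r:ℂ)^4))
  have hI : (∫ x in (-t)..t, g x * gkK r (x - s)) =
      (r:ℂ) * ((∫ x in (-t)..t, g x * Complex.exp (2 * Complex.I * (r:ℂ)^4 * ((x - s : ℝ) : ℂ))) -
       Complex.I * ∫ x in (-t)..t, g x * Complex.exp (-(2 * Complex.I * (r:ℂ)^4) * ((x - s : ℝ) : ℂ))) := by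
    rw [← intervalIntegral.integral_const_mul, ← intervalIntegral.integral_sub
      (Continuous.intervalIntegrable (by fun_prop) _ _)
      (Continuous.intervalIntegrable (by fun_prop) _ _), ← intervalIntegral.integral_const_mul]
    congr 1; ext x
    rw [gkK, ← neg_mul]; ring
  rw [hI, gkK, gkK]
  set X := ∫ s' in (-t)..t, f s' * Complex.exp (2 * Complex.I * (r:ℂ) ^ 4 * ((s' : ℂ) - (s : ℂ)))
  set Y := ∫ s' in (-t)..t, f s' * Complex.exp (-(2 * Complex.I * (r:ℂ) ^ 4) * ((s' : ℂ) - (s : ℂ)))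
  have n1 : ∀ y : ℂ, -(2 * Complex.I * (r:ℂ)^4 * y) = -(2 * Complex.I * (r:ℂ)^4) * y :=
    fun y => by ring
  rw [n1, n1, one_div, ← div_eq_inv_mul, eq_div_iff (by simp)]
  linear_combination (r:ℂ) * i1 - Complex.I * (r:ℂ) * i2

lemma gk_sqrt_int (a b : ℝ) : IntervalIntegrable (fun x => (Real.sqrt x)⁻¹) volume a b := by
  have h := intervalIntegral.intervalIntegrable_rpow' (a := a) (b := b) (r := -(1/2)) (by norm_num)
  convert h using 2 with x
  rcases lt_or_ge x 0 with hx | hx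
  · rw [Real.sqrt_eq_zero_of_nonpos hx.le, Real.rpow_def_of_neg hx]
    have : Real.cos (-(1/2) * Real.pi) = 0 := by
      rw [show -(1/2) * Real.pi = -(Real.pi/2) by ring, Real.cos_neg, Real.cos_pi_div_two]
    simp only [this, mul_zero, inv_zero]
  · rw [Real.rpow_neg hx, Real.sqrt_eq_rpow]

lemma gk_abs_sqrt_int (a b s : ℝ) :
    IntervalIntegrable (fun x => (Real.sqrt |x - s|)⁻¹) volume a b := by
  have h0 : ∀ a b : ℝ, IntervalIntegrable (fun x => (Real.sqrt |x|)⁻¹) volume a b := by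
    intro a b
    have h1 := gk_sqrt_int a b
    have h2 := (IntervalIntegrable.iff_comp_neg).mp (gk_sqrt_int (-a) (-b))
    simp only [neg_neg] at h2
    convert h1.add h2 using 2 with x
    rcases le_total x 0 with hx | hx
    · simp [abs_of_nonpos hx, Real.sqrt_eq_zero_of_nonpos hx]
    · simp [abs_of_nonneg hx, Real.sqrt_eq_zero_of_nonpos (neg_nonpos.mpr hx)]
  have := (h0 (a - s) (b - s)).comp_sub_right s
  simpa using this

lemma gkE_eq_K (R τ : ℝ) : gkE R τ = ∫ r in (0:ℝ)..R, gkK r τ := rfl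

lemma gkE_cont (R : ℝ) : Continuous (gkE R) := by
  have : gkE R = fun τ => ∫ r in (0:ℝ)..R, gkK r τ := by ext τ; rfl
  rw [this]
  apply intervalIntegral.continuous_parametric_intervalIntegral_of_continuous'
  exact gkK_cont.comp continuous_swap

lemma gk_main (f g : ℝ → ℂ) (t s : ℝ) (ht : 0 < t) (hs1 : -t < s) (hs2 : s < t)
    (hg : Continuous g) (hf : ∀ x ∈ Set.Icc (-t) t, HasDerivAt f (g x) x) :
    Tendsto (fun R => gammaTrunc
        (fun k => k ^ 5 * ∫ s' in (-t)..t,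
          f s' * Complex.exp (2 * Complex.I * k ^ 4 * ((s' : ℂ) - (s : ℂ)))) R)
      atTop (nhds (1 / (2 * Complex.I) * (f t * gkL (t - s) - f (-t) * gkL (-t - s) -
        ∫ x in (-t)..t, g x * gkL (x - s)))) := by
  have hle : -t ≤ t := by linarith
  have hK : ∀ τ, Continuous (fun r => gkK r τ) := fun τ =>
    gkK_cont.comp (continuous_id.prodMk continuous_const)
  have hgK : Continuous (fun p : ℝ × ℝ => g p.2 * gkK p.1 (p.2 - s)) :=
    (hg.comp continuous_snd).mul
      (gkK_cont.comp (continuous_fst.prodMk (continuous_snd.sub continuous_const)))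
  have hEq : ∀ R, gammaTrunc (fun k => k ^ 5 * ∫ s' in (-t)..t,
          f s' * Complex.exp (2 * Complex.I * k ^ 4 * ((s' : ℂ) - (s : ℂ)))) R =
      1 / (2 * Complex.I) * (f t * gkE R (t - s) - f (-t) * gkE R (-t - s) -
        ∫ x in (-t)..t, g x * gkE R (x - s)) := by
    intro R
    unfold gammaTrunc
    simp only [gk_pointwise f g t s ht hg hf]
    have c1' : Continuous (fun r => f t * gkK r (t - s)) := continuous_const.mul (hK _)
    have c2' : Continuous (fun r => f (-t) * gkK r (-t - s)) := continuous_const.mul (hK _)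
    have c4' : Continuous (fun r => f t * gkK r (t - s) - f (-t) * gkK r (-t - s)) := c1'.sub c2'
    have c3' : Continuous (fun r => ∫ x in (-t)..t, g x * gkK r (x - s)) :=
      intervalIntegral.continuous_parametric_intervalIntegral_of_continuous' hgK _ _
    rw [intervalIntegral.integral_const_mul, intervalIntegral.integral_sub
      (c4'.intervalIntegrable _ _) (c3'.intervalIntegrable _ _),
      intervalIntegral.integral_sub (c1'.intervalIntegrable _ _) (c2'.intervalIntegrable _ _),
      intervalIntegral.integral_const_mul, intervalIntegral.integral_const_mul,
      ← gkE_eq_K, ← gkE_eq_K, MeasureTheory.intervalIntegral_intervalIntegral_swap]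
    · simp only [intervalIntegral.integral_const_mul, ← gkE_eq_K]
    · have hc : IsCompact (Set.uIcc (0:ℝ) R ×ˢ Set.uIcc (-t) t) := isCompact_uIcc.prod isCompact_uIcc
      exact (hgK.continuousOn.integrableOn_compact hc).mono_set
        (Set.prod_mono Set.uIoc_subset_uIcc Set.uIoc_subset_uIcc)
  simp only [hEq]
  obtain ⟨M, hM⟩ := (isCompact_uIcc (a := -t) (b := t)).exists_bound_of_continuousOn hg.continuousOn
  have hM0 : 0 ≤ M := (norm_nonneg _).trans (hM (-t) Set.left_mem_uIcc)
  have hne : ∀ᵐ x : ℝ, x ≠ s := by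
    simp [ae_iff, measure_singleton]
  refine Tendsto.const_mul _ (((gkE_tendsto _ (by linarith [hs2] : t - s ≠ 0)).const_mul _).sub
    ((gkE_tendsto _ (by linarith : -t - s ≠ 0)).const_mul _) |>.sub ?_)
  refine intervalIntegral.tendsto_integral_filter_of_dominated_convergence
    (fun x => M * ((‖c1‖ + 1) * (Real.sqrt |x - s|)⁻¹)) ?_ ?_ ?_ ?_
  · refine Filter.Eventually.of_forall fun R => ?_
    have : Continuous fun x => g x * gkE R (x - s) :=
      hg.mul ((gkE_cont R).comp (continuous_id.sub continuous_const))
    exact this.aestronglyMeasurable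
  · filter_upwards [eventually_gt_atTop 0] with R hR
    filter_upwards [hne] with x hx hxm
    rw [norm_mul]
    exact mul_le_mul (hM x (Set.uIoc_subset_uIcc hxm)) (gkE_bound _ (sub_ne_zero.mpr hx) R hR)
      (norm_nonneg _) hM0
  · exact ((gk_abs_sqrt_int _ _ s).const_mul _).const_mul _
  · filter_upwards [hne] with x hx _
    exact (gkE_tendsto _ (sub_ne_zero.mpr hx)).const_mul _

lemma gk_L_int (g : ℝ → ℂ) (t s : ℝ) (hs1 : -t < s) (hs2 : s < t)
    (hg : Continuous g) :
    (∫ x in (-t)..t, g x * gkL (x - s)) =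
      c1 * ∫ x in (-t)..s, g x / (Real.sqrt (s - x) : ℂ) := by
  have e1 : ∀ x, x ∈ Set.uIoc (-t) s → (fun x => c1 * (g x / (Real.sqrt (s - x) : ℂ))) x =
      (fun x => g x * gkL (x - s)) x := by
    intro x hx
    rw [Set.uIoc_of_le hs1.le] at hx
    simp only [gkL]
    split_ifs with h
    · rw [neg_sub]; ring
    · have : x = s := le_antisymm hx.2 (by linarith)
      simp [this]
  have e2 : ∀ x, x ∈ Set.uIoc s t → (fun _ => (0:ℂ)) x = (fun x => g x * gkL (x - s)) x := by
    intro x hx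
    rw [Set.uIoc_of_le hs2.le] at hx
    have : ¬ (x - s < 0) := by linarith [hx.1]
    simp [gkL, this]
  have i0 : IntervalIntegrable (fun x => c1 * (g x / (Real.sqrt (s - x) : ℂ))) volume (-t) s := by
    apply IntervalIntegrable.const_mul
    have h := (gk_sqrt_int (s + t) 0).comp_sub_left s
    simp only [sub_zero, sub_add_cancel_left] at h
    have h2 : IntervalIntegrable (fun x => (((Real.sqrt (s - x))⁻¹ : ℝ) : ℂ)) volume (-t) s := by
      exact ⟨h.1.ofReal, h.2.ofReal⟩
    have h3 := h2.continuousOn_mul hg.continuousOn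
    simpa [div_eq_mul_inv] using h3
  have i1 := i0.congr e1
  have i2 : IntervalIntegrable (fun x => g x * gkL (x - s)) volume s t :=
    IntervalIntegrable.congr e2 (by simp)
  rw [← intervalIntegral.integral_add_adjacent_intervals i1 i2,
    ← intervalIntegral.integral_const_mul,
    ← intervalIntegral.integral_congr_ae (Filter.Eventually.of_forall e1),
    ← intervalIntegral.integral_congr_ae (Filter.Eventually.of_forall e2)]
  simp

/-- For `-t < s < t` and `F(t,·)` of class `C¹` on `[-t,t]`:
`∫_γ k⁵ ∫_{-t}^t F(t,s') e^{2ik⁴(s'-s)} ds' dk = -(c₁π/(2i)) (𝒜⁻¹F)(t,s)`. -/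
theorem gamma_k5_integral (F : ℝ → ℝ → ℂ) (t s : ℝ) (ht : 0 < t)
    (hs1 : -t < s) (hs2 : s < t)
    (hdiff : ∀ s' ∈ Set.Icc (-t) t, DifferentiableAt ℝ (F t) s')
    (hcont : ContinuousOn (deriv (F t)) (Set.Icc (-t) t)) :
    Tendsto (fun R => gammaTrunc
        (fun k => k ^ 5 * ∫ s' in (-t)..t,
          F t s' * Complex.exp (2 * Complex.I * k ^ 4 * ((s' : ℂ) - (s : ℂ)))) R)
      atTop (nhds (-(c1 * Real.pi / (2 * Complex.I)) * abelInv F t s)) := by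
  have hle : -t ≤ t := by linarith
  set g : ℝ → ℂ := Set.IccExtend hle ((Set.Icc (-t) t).domRestrict (deriv (F t))) with hgdef
  have hg : Continuous g := hcont.domRestrict.Icc_extend'
  have hge : ∀ x ∈ Set.Icc (-t) t, g x = deriv (F t) x := by
    intro x hx
    rw [hgdef, Set.IccExtend_of_mem hle _ hx]; rfl
  have hf : ∀ x ∈ Set.Icc (-t) t, HasDerivAt (F t) (g x) x := by
    intro x hx
    rw [hge x hx]; exact (hdiff x hx).hasDerivAt
  have h := gk_main (F t) g t s ht hs1 hs2 hg hf
  convert h using 2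
  rw [gk_L_int g t s hs1 hs2 hg]
  have hi : (∫ s' in (-t)..s, deriv (F t) s' / (Real.sqrt (s - s') : ℂ)) =
      ∫ x in (-t)..s, g x / (Real.sqrt (s - x) : ℂ) := by
    apply intervalIntegral.integral_congr
    intro x hx
    rw [Set.uIcc_of_le hs1.le] at hx
    simp only []
    rw [hge x ⟨hx.1, hx.2.trans hs2.le⟩]
  have l1 : gkL (t - s) = 0 := by rw [gkL, if_neg]; linarith
  have l2 : gkL (-t - s) = c1 / (Real.sqrt (t + s) : ℂ) := by
    rw [gkL, if_pos (by linarith)]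
    congr 3; ring
  rw [l1, l2, abelInv, hi]
  have hpi : (Real.pi : ℂ) ≠ 0 := by exact_mod_cast Real.pi_ne_zero
  field_simp
  ring
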